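/- Let q ≥ 1 and let a, b, c, h be integers with gcd(h, q) = 1 and gcd(abc, q) = 1, and write n = abc. Then R_{a,b,c}(h/q) = q · S_{1, h̄n}(q), where h̄ denotes the multiplicative inverse of h modulo q. -/

import Mathlib

open scoped BigOperators

/-- `e(t) = exp(2πit)` -/
noncomputable def e (t : ℝ) : ℂ := Complex.exp (2 * Real.pi * Complex.I * t)

/-- `R_{a,b,c}(h/q) = Σ_{x,y,z=1}^{q} e((ax + by + cz − hxyz)/q)` -/
noncomputable def Rabc (a b c h : ℤ) (q : ℕ) : ℂ :=
  ∑ x ∈ Finset.Icc 1 q, ∑ y ∈ Finset.Icc 1 q, ∑ z ∈ Finset.Icc 1 q,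
    e (((a * x + b * y + c * z - h * x * y * z : ℤ) : ℝ) / q)

/-- Kloosterman's sum `S_{n,m}(q) = Σ′_{a=1}^{q} e((na + m·ā)/q)`, where `ā` is the
inverse of `a` modulo `q`. -/
noncomputable def kloosterman (n m : ℤ) (q : ℕ) : ℂ :=
  ∑ a ∈ (Finset.Icc 1 q).filter (fun a => Nat.Coprime a q),
    e (((n * a + m * (((a : ZMod q)⁻¹).val : ℤ) : ℤ) : ℝ) / q)

theorem sum_Icc_natCast_zmod (q : ℕ) [NeZero q] (f : ZMod q → ℂ) :
    ∑ x ∈ Finset.Icc 1 q, f (x : ZMod q) = ∑ x : ZMod q, f x := by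
  have hq : 0 < q := Nat.pos_of_neZero q
  refine Finset.sum_bij (fun x _ => (x : ZMod q)) (fun _ _ => Finset.mem_univ _) ?_ ?_
    (fun _ _ => rfl)
  · intro x hx y hy hxy
    rw [Finset.mem_Icc] at hx hy
    have h : x ≡ y [MOD q] := (ZMod.natCast_eq_natCast_iff x y q).1 hxy
    obtain ⟨x, rfl⟩ : ∃ k, x = k + 1 := ⟨x - 1, by omega⟩
    obtain ⟨y, rfl⟩ : ∃ k, y = k + 1 := ⟨y - 1, by omega⟩
    have h' := Nat.ModEq.add_right_cancel' 1 h
    rw [h'.eq_of_lt_of_lt (by omega) (by omega)]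
  · intro t _
    by_cases ht : t = 0
    · exact ⟨q, Finset.mem_Icc.2 ⟨hq, le_rfl⟩, by simp [ht]⟩
    · have hv : t.val ≠ 0 := by simpa [ZMod.val_eq_zero] using ht
      exact ⟨t.val, Finset.mem_Icc.2 ⟨by omega, (ZMod.val_lt t).le⟩, by simp⟩

theorem e_intCast_div (q : ℕ) [NeZero q] (j : ℤ) :
    e ((j : ℝ) / q) = ZMod.stdAddChar (N := q) (j : ZMod q) := by
  rw [ZMod.stdAddChar_coe, e]
  push_cast
  congr 1
  ring

theorem kloosterman_eq_sum_zmod (q : ℕ) [NeZero q] (n m : ℤ) :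
    kloosterman n m q = ∑ x : ZMod q,
      open Classical in
      if IsUnit x then ZMod.stdAddChar (N := q) (n * x + m * x⁻¹) else 0 := by
  classical
  rw [← sum_Icc_natCast_zmod, kloosterman, Finset.sum_filter]
  refine Finset.sum_congr rfl fun x _ => ?_
  simp only [ZMod.isUnit_iff_coprime, e_intCast_div]
  push_cast
  simp

theorem Rabc_eq_sum_zmod (q : ℕ) [NeZero q] (a b c h : ℤ) :
    Rabc a b c h q = ∑ x : ZMod q, ∑ y : ZMod q, ∑ z : ZMod q,
      ZMod.stdAddChar (N := q) (a * x + b * y + c * z - h * x * y * z) := by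
  simp only [← sum_Icc_natCast_zmod, Rabc, e_intCast_div]
  push_cast
  rfl

theorem sum_zmod_stdAddChar_trilinear (q : ℕ) [NeZero q] (a b c h k x : ZMod q)
    (hc : IsUnit c) (hk : h * k = 1) :
    ∑ y : ZMod q, ∑ z : ZMod q,
      ZMod.stdAddChar (N := q) (a * x + b * y + c * z - h * x * y * z) =
    q * (open Classical in
      if IsUnit x then ZMod.stdAddChar (N := q) (a * x + k * (b * c) * x⁻¹) else 0) := by
  classical
  have hz (y : ZMod q) : ∑ z : ZMod q,
      ZMod.stdAddChar (N := q) (a * x + b * y + c * z - h * x * y * z) =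
      if c - h * x * y = 0 then q * ZMod.stdAddChar (N := q) (a * x + b * y) else 0 := by
    have hs := AddChar.sum_mulShift (c - h * x * y) (ZMod.isPrimitive_stdAddChar q)
    rw [ZMod.card] at hs
    have hsplit (z : ZMod q) :
        ZMod.stdAddChar (N := q) (a * x + b * y + c * z - h * x * y * z) =
        ZMod.stdAddChar (N := q) (a * x + b * y) *
          ZMod.stdAddChar (N := q) (z * (c - h * x * y)) := by
      rw [← AddChar.map_add_eq_mul]
      congr 1
      ring
    simp only [hsplit, ← Finset.mul_sum, hs]
    split_ifs <;> push_cast <;> ring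
  simp only [hz]
  split_ifs with hx
  · have hinv := ZMod.mul_inv_of_unit x hx
    rw [Finset.sum_eq_single (k * c * x⁻¹)]
    · rw [if_pos (by linear_combination (-c * x * x⁻¹) * hk - c * hinv)]
      congr 3
      ring
    · intro y _ hy
      refine if_neg fun h0 => hy ?_
      linear_combination (-k * x⁻¹) * h0 - y * hinv - (x * x⁻¹ * y) * hk
    · simp
  · rw [mul_zero]
    refine Finset.sum_eq_zero fun y _ => if_neg fun h0 => hx ?_
    rw [sub_eq_zero] at h0
    rw [h0] at hc
    exact isUnit_of_mul_isUnit_right (isUnit_of_mul_isUnit_left hc)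

/-- For `gcd(h,q) = gcd(abc,q) = 1` and `n = abc`:
`R_{a,b,c}(h/q) = q · S_{1, h̄n}(q)` where `h̄` is the inverse of `h` mod `q`. -/
theorem stmt10 (q : ℕ) (hq : 1 ≤ q) (a b c h : ℤ)
    (hh : Int.gcd h q = 1) (habc : Int.gcd (a * b * c) q = 1)
    (hbar : ℤ) (hhbar : (h * hbar) % (q : ℤ) = 1 % (q : ℤ)) :
    Rabc a b c h q = (q : ℂ) * kloosterman 1 (hbar * (a * b * c)) q := by
  classical
  have : NeZero q := ⟨by omega⟩
  have hk : (h : ZMod q) * hbar = 1 := by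
    exact_mod_cast (ZMod.intCast_eq_intCast_iff (h * hbar) 1 q).2 hhbar
  have hu : IsUnit ((a : ZMod q) * b * c) := by
    have := (ZMod.coe_int_isUnit_iff_isCoprime (a * b * c) q).2
      (Int.isCoprime_iff_gcd_eq_one.2 habc).symm
    exact_mod_cast this
  have hc : IsUnit (c : ZMod q) := isUnit_of_mul_isUnit_right hu
  obtain ⟨u, ha⟩ : IsUnit (a : ZMod q) :=
    isUnit_of_mul_isUnit_left (isUnit_of_mul_isUnit_left hu)
  rw [kloosterman_eq_sum_zmod, ← Equiv.sum_comp (Units.mulLeft u), Finset.mul_sum,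
    Rabc_eq_sum_zmod]
  refine Finset.sum_congr rfl fun x _ => ?_
  rw [sum_zmod_stdAddChar_trilinear q a b c h hbar x hc hk, Units.mulLeft_apply]
  simp only [Units.isUnit_units_mul]
  rw [ha]
  split_ifs with hx
  · have hinv := ZMod.mul_inv_of_unit x hx
    have hinv' := ZMod.mul_inv_of_unit ((a : ZMod q) * x) (ha ▸ u.isUnit.mul hx)
    congr 2
    push_cast
    linear_combination (hbar * b * c * a * ((a : ZMod q) * x)⁻¹) * hinv -
      (hbar * b * c * x⁻¹) * hinv'
  · rfl
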